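/- Fix H ∈ (0, 1/2) and T > 0, and set g(t) = t^{H − 1/2} for t > 0 and G(t) = ∫_0^t g(s)² ds = t^{2H}/(2H). Let k, θ, δ ≥ 0 and let μ, m be positive measures on (0, ∞) with ∫_0^∞ (z ∧ 1)[μ(dz) + m(dz)] < ∞. Define R(u) = −k u + (δ²/2) u² + ∫_0^∞ (e^{zu} − 1) μ(dz) and F(u) = k θ u + ∫_0^∞ (e^{zu} − 1) m(dz). Suppose there exists A > 0 such that ∫_1^∞ z e^{zA} [μ(dz) + m(dz)] < ∞ and 2 G(T) + T · max(0, R(A)) ≤ A. Then there exist continuous functions ψ, φ : [0, T] → ℝ with ψ(0) = φ(0) = 0 satisfying the integral equations ψ(t) = ∫_0^t ( 2 g(s)² + R(ψ(s)) ) ds and φ(t) = ∫_0^t F(ψ(s)) ds for all t ∈ [0, T], and these solutions satisfy the bounds 0 ≤ ψ(t) ≤ A and 0 ≤ φ(t) ≤ T · F(A) for all t ∈ [0, T]. -/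

import Mathlib

open MeasureTheory Real Set

section ExpMoment

variable {A : ℝ} {ν : Measure ℝ}

lemma integrableOn_mul_exp_of_lintegral_lt_top (hA : 0 ≤ A)
    (h_small : ∫⁻ z in Ioi (0 : ℝ), ENNReal.ofReal (min z 1) ∂ν < ⊤)
    (h_exp : ∫⁻ z in Ioi (1 : ℝ), ENNReal.ofReal (z * exp (z * A)) ∂ν < ⊤) :
    IntegrableOn (fun z => z * exp (z * A)) (Ioi 0) ν := by
  rw [← Ioc_union_Ioi_eq_Ioi (zero_le_one' ℝ)]
  refine IntegrableOn.union ?_ ?_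
  · have hmin : IntegrableOn (fun z : ℝ => min z 1) (Ioi 0) ν := by
      refine (lintegral_ofReal_ne_top_iff_integrable (by fun_prop) ?_).1 h_small.ne
      filter_upwards [ae_restrict_mem measurableSet_Ioi] with z hz
      exact le_min (le_of_lt hz) zero_le_one
    refine Integrable.mono' ((hmin.mono_set Ioc_subset_Ioi_self).mul_const (exp A)) (by fun_prop) ?_
    filter_upwards [ae_restrict_mem measurableSet_Ioc] with z hz
    rw [norm_of_nonneg (mul_nonneg hz.1.le (exp_pos _).le), min_eq_left hz.2]
    gcongr
    · exact hz.1.le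
    · exact mul_le_of_le_one_left hA hz.2
  · refine (lintegral_ofReal_ne_top_iff_integrable (by fun_prop) ?_).1 h_exp.ne
    filter_upwards [ae_restrict_mem measurableSet_Ioi] with z hz
    exact mul_nonneg (zero_le_one.trans (le_of_lt hz)) (exp_pos _).le

lemma exp_mul_sub_exp_mul_le {z u v : ℝ} (hz : 0 ≤ z) (hvu : v ≤ u) (huA : u ≤ A) :
    exp (z * u) - exp (z * v) ≤ z * exp (z * A) * (u - v) := by
  have h1 : exp (z * v) = exp (z * u) * exp (z * v - z * u) := by rw [← exp_add]; ring_nf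
  have h2 := add_one_le_exp (z * v - z * u)
  have h3 : exp (z * u) ≤ exp (z * A) := by gcongr
  have h4 : 0 ≤ z * (u - v) := mul_nonneg hz (by linarith)
  rw [h1]
  nlinarith [mul_le_mul_of_nonneg_right h3 h4, mul_le_mul_of_nonneg_left h2 (exp_pos (z * u)).le]

lemma integrableOn_exp_mul_sub_one (hw : IntegrableOn (fun z => z * exp (z * A)) (Ioi 0) ν)
    {u : ℝ} (hu : u ∈ Icc 0 A) : IntegrableOn (fun z => exp (z * u) - 1) (Ioi 0) ν := by
  refine Integrable.mono' (hw.mul_const u) (by fun_prop) ?_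
  filter_upwards [ae_restrict_mem measurableSet_Ioi] with z hz
  have hz' : 0 ≤ z := le_of_lt hz
  rw [norm_of_nonneg (sub_nonneg.2 (one_le_exp (mul_nonneg hz' hu.1)))]
  simpa using exp_mul_sub_exp_mul_le hz' hu.1 hu.2

lemma monotoneOn_integral_exp_mul_sub_one
    (hw : IntegrableOn (fun z => z * exp (z * A)) (Ioi 0) ν) :
    MonotoneOn (fun u => ∫ z in Ioi (0 : ℝ), (exp (z * u) - 1) ∂ν) (Icc 0 A) := by
  intro u hu v hv huv
  refine setIntegral_mono_on (integrableOn_exp_mul_sub_one hw hu)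
    (integrableOn_exp_mul_sub_one hw hv) measurableSet_Ioi fun z hz => ?_
  have hz' : 0 ≤ z := le_of_lt hz
  gcongr

lemma lipschitzOnWith_integral_exp_mul_sub_one
    (hw : IntegrableOn (fun z => z * exp (z * A)) (Ioi 0) ν) :
    LipschitzOnWith (∫ z in Ioi (0 : ℝ), z * exp (z * A) ∂ν).toNNReal
      (fun u => ∫ z in Ioi (0 : ℝ), (exp (z * u) - 1) ∂ν) (Icc 0 A) := by
  refine LipschitzOnWith.of_le_add_mul _ fun u hu v hv => ?_
  have hK : 0 ≤ ∫ z in Ioi (0 : ℝ), z * exp (z * A) ∂ν :=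
    setIntegral_nonneg measurableSet_Ioi fun z hz => mul_nonneg (le_of_lt hz) (exp_pos _).le
  rw [coe_toNNReal _ hK, dist_eq]
  rcases le_total u v with huv | hvu
  · exact (monotoneOn_integral_exp_mul_sub_one hw hu hv huv).trans
      (le_add_of_nonneg_right (mul_nonneg hK (abs_nonneg _)))
  · rw [abs_of_nonneg (sub_nonneg.2 hvu), ← integral_mul_const,
      ← integral_add (integrableOn_exp_mul_sub_one hw hv) (hw.mul_const _)]
    refine setIntegral_mono_on (integrableOn_exp_mul_sub_one hw hu)
      ((integrableOn_exp_mul_sub_one hw hv).add (hw.mul_const _)) measurableSet_Ioi fun z hz => ?_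
    linarith [exp_mul_sub_exp_mul_le (le_of_lt hz) hvu hu.2]

lemma integral_exp_mul_sub_one_le (hA : 0 < A)
    (hw : IntegrableOn (fun z => z * exp (z * A)) (Ioi 0) ν) {u : ℝ} (hu : u ∈ Icc 0 A) :
    ∫ z in Ioi (0 : ℝ), (exp (z * u) - 1) ∂ν
      ≤ u / A * ∫ z in Ioi (0 : ℝ), (exp (z * A) - 1) ∂ν := by
  rw [← integral_const_mul]
  refine setIntegral_mono_on (integrableOn_exp_mul_sub_one hw hu)
    ((integrableOn_exp_mul_sub_one hw (right_mem_Icc.2 hA.le)).const_mul _)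
    measurableSet_Ioi fun z _ => ?_
  have h := convexOn_exp.2 (mem_univ (z * A)) (mem_univ 0) (div_nonneg hu.1 hA.le)
    (sub_nonneg.2 ((div_le_one hA).2 hu.2)) (add_sub_cancel _ _)
  have hzu : u / A * (z * A) = z * u := by field_simp
  simp only [smul_eq_mul, mul_zero, add_zero, exp_zero, mul_one, hzu] at h
  linarith

end ExpMoment

/-- Global existence for `ψ = q + ∫ f ∘ ψ` with `f` bounded and Lipschitz and `q` continuous. -/
lemma exists_continuousOn_eq_add_integral {f q : ℝ → ℝ} {K L : NNReal} {T : ℝ} (hT : 0 ≤ T)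
    (hf : LipschitzWith K f) (hL : ∀ u, |f u| ≤ L) (hq : ContinuousOn q (Icc 0 T)) :
    ∃ ψ : ℝ → ℝ, ContinuousOn ψ (Icc 0 T) ∧
      ∀ t ∈ Icc 0 T, ψ t = q t + ∫ s in (0 : ℝ)..t, f (ψ s) := by
  have hpl : IsPicardLindelof (fun t x => f (x + q t)) (⟨0, left_mem_Icc.2 hT⟩ : Icc 0 T) (0 : ℝ)
      (L * T.toNNReal) 0 L K :=
    { lipschitzOnWith := fun t _ => by
        refine LipschitzWith.lipschitzOnWith (LipschitzWith.of_dist_le_mul fun x y => ?_)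
        simpa using hf.dist_le_mul (x + q t) (y + q t)
      continuousOn := fun x _ => hf.continuous.comp_continuousOn (continuousOn_const.add hq)
      norm_le := fun t _ x _ => hL _
      mul_max_le := by simp [hT] }
  obtain ⟨x, hx0, hx⟩ := hpl.exists_eq_forall_mem_Icc_hasDerivWithinAt₀
  have hxc : ContinuousOn x (Icc 0 T) := fun t ht => (hx t ht).continuousWithinAt
  have hψc : ContinuousOn (fun t => x t + q t) (Icc 0 T) := hxc.add hq
  refine ⟨fun t => x t + q t, hψc, fun t ht => ?_⟩
  have hsub : Icc 0 t ⊆ Icc 0 T := Icc_subset_Icc_right ht.2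
  have hint : ∫ s in (0 : ℝ)..t, f (x s + q s) = x t - x 0 := by
    refine intervalIntegral.integral_eq_sub_of_hasDeriv_right_of_le ht.1 (hxc.mono hsub)
      (fun s hs => ?_) ?_
    · have hs' := (hx s (hsub (Ioo_subset_Icc_self hs))).hasDerivAt
        (Icc_mem_nhds hs.1 (hs.2.trans_le ht.2))
      exact hs'.hasDerivWithinAt
    · refine ContinuousOn.intervalIntegrable ?_
      rw [uIcc_of_le ht.1]
      exact (hf.continuous.comp_continuousOn hψc).mono hsub
  have hx0' : x 0 = 0 := hx0
  simp only [hint, hx0']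
  ring

/-- Since `f` vanishes on the negative half-line, `ψ = q + ∫ f ∘ ψ` cannot become negative when
`q` is nondecreasing from `q 0 = 0`. -/
lemma nonneg_of_eq_add_integral {f q ψ : ℝ → ℝ} {T : ℝ} (hf : Continuous f)
    (hf0 : ∀ u ≤ 0, f u = 0) (hq : MonotoneOn q (Icc 0 T)) (hq0 : q 0 = 0)
    (hψ : ContinuousOn ψ (Icc 0 T))
    (hψq : ∀ t ∈ Icc 0 T, ψ t = q t + ∫ s in (0 : ℝ)..t, f (ψ s)) {t : ℝ} (ht : t ∈ Icc 0 T) :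
    0 ≤ ψ t := by
  have hsub : Icc 0 t ⊆ Icc 0 T := Icc_subset_Icc_right ht.2
  have hint : ∀ {a b}, a ∈ Icc 0 T → b ∈ Icc 0 T →
      IntervalIntegrable (fun s => f (ψ s)) volume a b := fun ha hb =>
    ((hf.comp_continuousOn hψ).mono (uIcc_subset_Icc ha hb)).intervalIntegrable
  have h0T : (0 : ℝ) ∈ Icc 0 T := ⟨le_rfl, ht.1.trans ht.2⟩
  have hcpt : IsCompact (Icc 0 t ∩ ψ ⁻¹' Ici 0) :=
    isCompact_Icc.of_isClosed_subset
      ((hψ.mono hsub).preimage_isClosed_of_isClosed isClosed_Icc isClosed_Ici) inter_subset_left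
  have hψ0 : ψ 0 = 0 := by simp [hψq 0 h0T, hq0]
  obtain ⟨r, ⟨hrt, hr⟩, hmax⟩ := hcpt.exists_isGreatest ⟨0, ⟨le_rfl, ht.1⟩, hψ0.ge⟩
  have hzero : ∫ s in r..t, f (ψ s) = 0 := by
    rw [intervalIntegral.integral_of_le hrt.2]
    refine setIntegral_eq_zero_of_forall_eq_zero fun s hs => hf0 _ ?_
    by_contra! hneg
    exact hs.1.not_ge (hmax ⟨⟨hrt.1.trans hs.1.le, hs.2⟩, hneg.le⟩)
  have hadd := intervalIntegral.integral_add_adjacent_intervals (hint h0T (hsub hrt))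
    (hint (hsub hrt) ht)
  have hqrt := hq (hsub hrt) ht hrt.2
  have hr' : 0 ≤ ψ r := hr
  linarith [hψq t ht, hψq r (hsub hrt)]

lemma integral_two_mul_rpow_sq {H t : ℝ} (hH0 : 0 < H) (ht : 0 ≤ t) :
    IntervalIntegrable (fun s : ℝ => 2 * (s ^ (H - 1 / 2)) ^ 2) volume 0 t ∧
      ∫ s in (0 : ℝ)..t, 2 * (s ^ (H - 1 / 2)) ^ 2 = 2 * (t ^ (2 * H) / (2 * H)) := by
  have hEq : EqOn (fun s : ℝ => 2 * s ^ (2 * H - 1)) (fun s => 2 * (s ^ (H - 1 / 2)) ^ 2)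
      (uIcc 0 t) := by
    intro s hs
    rw [uIcc_of_le ht] at hs
    have : s ^ (2 * H - 1) = (s ^ (H - 1 / 2)) ^ 2 := by
      rw [← rpow_natCast, ← rpow_mul hs.1]
      congr 1
      push_cast
      ring
    simp only [this]
  have hint : IntervalIntegrable (fun s : ℝ => 2 * s ^ (2 * H - 1)) volume 0 t :=
    (intervalIntegral.intervalIntegrable_rpow' (by linarith)).const_mul 2
  refine ⟨hint.congr (hEq.mono uIoc_subset_uIcc), ?_⟩
  rw [← intervalIntegral.integral_congr hEq, intervalIntegral.integral_const_mul,
    integral_rpow (Or.inl (by linarith)), sub_add_cancel, zero_rpow (by linarith), sub_zero]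

open MeasureTheory Real Set

/-- Existence of a solution `(ψ, φ)` on `[0, T]`, in integral form, of the Riccati ODE
`ψ' = 2 g² + R ∘ ψ`, `φ' = F ∘ ψ`, `ψ(0) = φ(0) = 0`, associated with the rough kernel
`g(t) = t^{H-1/2}` (so `G(t) = t^{2H}/(2H)`), together with the bounds
`0 ≤ ψ ≤ A` and `0 ≤ φ ≤ T·F(A)`. -/
theorem riccati_solution_exists
    (H T : ℝ) (hH0 : 0 < H) (hH : H < 1 / 2) (hT : 0 < T)
    (k θ δ : ℝ) (hk : 0 ≤ k) (hθ : 0 ≤ θ) (hδ : 0 ≤ δ)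
    (μ m : Measure ℝ)
    (h_small : ∫⁻ z in Ioi (0 : ℝ), ENNReal.ofReal (min z 1) ∂(μ + m) < ⊤)
    (g G R F : ℝ → ℝ)
    (hg : ∀ t, g t = t ^ (H - 1 / 2))
    (hG : ∀ t, G t = t ^ (2 * H) / (2 * H))
    (hR : ∀ u, R u = -k * u + δ ^ 2 / 2 * u ^ 2
      + ∫ z in Ioi (0 : ℝ), (exp (z * u) - 1) ∂μ)
    (hF : ∀ u, F u = k * θ * u + ∫ z in Ioi (0 : ℝ), (exp (z * u) - 1) ∂m)
    (A : ℝ) (hA : 0 < A)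
    (h_exp : ∫⁻ z in Ioi (1 : ℝ), ENNReal.ofReal (z * exp (z * A)) ∂(μ + m) < ⊤)
    (h_bound : 2 * G T + T * max 0 (R A) ≤ A) :
    ∃ ψ φ : ℝ → ℝ,
      ContinuousOn ψ (Icc 0 T) ∧ ContinuousOn φ (Icc 0 T) ∧
      ψ 0 = 0 ∧ φ 0 = 0 ∧
      (∀ t ∈ Icc (0 : ℝ) T,
        ψ t = ∫ s in (0 : ℝ)..t, (2 * g s ^ 2 + R (ψ s)) ∧
        φ t = ∫ s in (0 : ℝ)..t, F (ψ s) ∧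
        ψ t ∈ Icc (0 : ℝ) A ∧ φ t ∈ Icc (0 : ℝ) (T * F A)) := by
  have hw := integrableOn_mul_exp_of_lintegral_lt_top hA.le h_small h_exp
  obtain ⟨hwμ, hwm⟩ := integrableOn_add_measure.1 hw
  have hR0 : R 0 = 0 := by simp [hR]
  have hF0 : F 0 = 0 := by simp [hF]
  have hFmono : MonotoneOn F (Icc 0 A) := fun u hu v hv huv => by
    have := monotoneOn_integral_exp_mul_sub_one hwm hu hv huv
    rw [hF, hF]
    exact add_le_add (mul_le_mul_of_nonneg_left huv (mul_nonneg hk hθ)) this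
  have hFcont : ContinuousOn F (Icc 0 A) := by
    rw [funext hF]
    exact (by fun_prop : ContinuousOn (fun u => k * θ * u) (Icc 0 A)).add
      (lipschitzOnWith_integral_exp_mul_sub_one hwm).continuousOn
  obtain ⟨K, hRlip⟩ : ∃ K, LipschitzOnWith K R (Icc 0 A) := by
    obtain ⟨K, hK⟩ : ∃ K, LipschitzOnWith K
        (fun u : ℝ => -k * u + δ ^ 2 / 2 * u ^ 2) (Icc 0 A) :=
      ContDiffOn.exists_lipschitzOnWith (n := 1) (by fun_prop) one_ne_zero (convex_Icc 0 A)
        isCompact_Icc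
    refine ⟨K + (∫ z in Ioi (0 : ℝ), z * exp (z * A) ∂μ).toNNReal, ?_⟩
    rw [funext hR]
    exact hK.add (lipschitzOnWith_integral_exp_mul_sub_one hwμ)
  have hRle : ∀ u ∈ Icc 0 A, R u ≤ max 0 (R A) := fun u hu => by
    have h0 : 0 ≤ u / A := div_nonneg hu.1 hA.le
    have h1 : u / A ≤ 1 := (div_le_one hA).2 hu.2
    have hquad : u ^ 2 ≤ u / A * A ^ 2 := by
      have : u / A * A ^ 2 = u * A := by field_simp
      nlinarith [hu.1, hu.2]
    have hlin : u = u / A * A := by field_simp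
    have hscale : R u ≤ u / A * R A := by
      have hJ := integral_exp_mul_sub_one_le hA hwμ hu
      have hδu := mul_le_mul_of_nonneg_left hquad (by positivity : 0 ≤ δ ^ 2 / 2)
      have hku : k * u = u / A * (k * A) := by linear_combination k * hlin
      rw [hR, hR]
      linarith
    calc R u ≤ u / A * R A := hscale
      _ ≤ u / A * max 0 (R A) := mul_le_mul_of_nonneg_left (le_max_right _ _) h0
      _ ≤ max 0 (R A) := mul_le_of_le_one_left (le_max_left _ _) h1
  -- Solve the equation with `R` replaced by its constant extension from `[0, A]`.
  set f : ℝ → ℝ := fun u => R (projIcc 0 A hA.le u) with hfdef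
  have hflip : LipschitzWith K f := by
    refine LipschitzWith.of_dist_le_mul fun u v => ?_
    refine (hRlip.dist_le_mul _ (projIcc 0 A hA.le u).2 _ (projIcc 0 A hA.le v).2).trans ?_
    gcongr
    simpa [Subtype.dist_eq] using (LipschitzWith.projIcc hA.le).dist_le_mul u v
  have hfneg : ∀ u ≤ 0, f u = 0 := fun u hu => by simp [hfdef, projIcc_of_le_left hA.le hu, hR0]
  have hfbdd : ∀ u, |f u| ≤ (K * A.toNNReal : NNReal) := fun u => by
    have h := hRlip.dist_le_mul _ (projIcc 0 A hA.le u).2 0 (left_mem_Icc.2 hA.le)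
    rw [hR0, dist_zero_right, dist_zero_right, norm_eq_abs, norm_eq_abs,
      abs_of_nonneg (projIcc 0 A hA.le u).2.1] at h
    rw [NNReal.coe_mul, coe_toNNReal _ hA.le]
    exact h.trans (mul_le_mul_of_nonneg_left (projIcc 0 A hA.le u).2.2 K.2)
  have hGcont : Continuous fun t => 2 * G t := by
    simp only [hG]
    exact continuous_const.mul ((continuous_rpow_const (by linarith)).div_const _)
  have hGmono : MonotoneOn (fun t => 2 * G t) (Icc 0 T) := fun s hs t _ hst => by
    simp only [hG]
    have := hs.1
    gcongr
  have hG0 : 2 * G 0 = 0 := by simp [hG, hH0.ne']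
  obtain ⟨ψ, hψc, hψ⟩ :=
    exists_continuousOn_eq_add_integral hT.le hflip hfbdd hGcont.continuousOn
  have hψint : ∀ t ∈ Icc 0 T, IntervalIntegrable (fun s => f (ψ s)) volume 0 t := fun t ht =>
    ((hflip.continuous.comp_continuousOn hψc).mono
      (uIcc_subset_Icc (left_mem_Icc.2 hT.le) ht)).intervalIntegrable
  have hψmem : ∀ t ∈ Icc 0 T, ψ t ∈ Icc 0 A := fun t ht => by
    refine ⟨nonneg_of_eq_add_integral hflip.continuous hfneg hGmono hG0 hψc hψ ht, ?_⟩
    have hle : ∫ s in (0 : ℝ)..t, f (ψ s) ≤ ∫ _ in (0 : ℝ)..t, max 0 (R A) :=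
      intervalIntegral.integral_mono_on ht.1 (hψint t ht) intervalIntegrable_const
        fun s _ => hRle _ (projIcc 0 A hA.le (ψ s)).2
    rw [intervalIntegral.integral_const, smul_eq_mul, sub_zero] at hle
    have htT := mul_le_mul_of_nonneg_right ht.2 (le_max_left 0 (R A))
    have hGt := hGmono ht (right_mem_Icc.2 hT.le) ht.2
    rw [hψ t ht]
    simp only at hGt
    linarith
  have hFψc : ContinuousOn (fun s => F (ψ s)) (Icc 0 T) := hFcont.comp hψc hψmem
  have hFψint : ∀ t ∈ Icc 0 T, IntervalIntegrable (fun s => F (ψ s)) volume 0 t := fun t ht =>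
    (hFψc.mono (uIcc_subset_Icc (left_mem_Icc.2 hT.le) ht)).intervalIntegrable
  have hFmem : ∀ u ∈ Icc 0 A, F u ∈ Icc 0 (F A) := fun u hu =>
    ⟨hF0 ▸ hFmono (left_mem_Icc.2 hA.le) hu hu.1, hFmono hu (right_mem_Icc.2 hA.le) hu.2⟩
  refine ⟨ψ, fun t => ∫ s in (0 : ℝ)..t, F (ψ s), hψc, ?_, ?_, ?_,
    fun t ht => ⟨?_, rfl, hψmem t ht, ?_, ?_⟩⟩
  · have h := intervalIntegral.continuousOn_primitive_interval (μ := volume)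
      (f := fun s => F (ψ s)) (a := 0) (b := T)
    rw [uIcc_of_le hT.le] at h
    exact h hFψc.integrableOn_Icc
  · simpa [hG0] using hψ 0 (left_mem_Icc.2 hT.le)
  · simp
  · obtain ⟨hgint, hgG⟩ := integral_two_mul_rpow_sq hH0 ht.1
    have hRf : ∫ s in (0 : ℝ)..t, (2 * g s ^ 2 + R (ψ s))
        = ∫ s in (0 : ℝ)..t, (2 * (s ^ (H - 1 / 2)) ^ 2 + f (ψ s)) := by
      refine intervalIntegral.integral_congr fun s hs => ?_
      rw [uIcc_of_le ht.1] at hs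
      simp only [hg, hfdef, projIcc_of_mem hA.le (hψmem s ⟨hs.1, hs.2.trans ht.2⟩)]
    rw [hRf, intervalIntegral.integral_add hgint (hψint t ht), hgG, hψ t ht, hG]
  · exact intervalIntegral.integral_nonneg ht.1 fun s hs =>
      (hFmem _ (hψmem s ⟨hs.1, hs.2.trans ht.2⟩)).1
  · have hle : ∫ s in (0 : ℝ)..t, F (ψ s) ≤ ∫ _ in (0 : ℝ)..t, F A :=
      intervalIntegral.integral_mono_on ht.1 (hFψint t ht) intervalIntegrable_const
        fun s hs => (hFmem _ (hψmem s ⟨hs.1, hs.2.trans ht.2⟩)).2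
    rw [intervalIntegral.integral_const, smul_eq_mul, sub_zero] at hle
    exact hle.trans (mul_le_mul_of_nonneg_right ht.2 (hFmem A (right_mem_Icc.2 hA.le)).1)
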